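/- Let A be an m × n real matrix and b ∈ ℝ^m. Let J : Fin m → Fin n be strictly monotone (a sorted column base j_1 < … < j_m) with the column submatrix A_J invertible, let u ∈ Fin m, and let x ∈ ℝ^n be the basic solution associated with J (x_{J(i)} = ((A_J)⁻¹ b)_i and x_j = 0 off the range of J). Assume x_{J(i)} ≥ 0 for all i < u and x_{J(u)} < 0. Furthermore, let C be an invertible m × m real matrix, set à = C A and b̃ = C b, and assume there is a row index r with: b̃_r < 0, Ã_{r,j} ≥ 0 for all column indices j < J(u), Ã_{r,J(u)} < 0, and Ã_{r,J(i)} = 0 for all i > u. Then this situation is contradictory (False); i.e., no such configuration exists. -/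

import Mathlib

open Matrix

/-- (Key step of the no-cycling proof for the phase-one rule.)
Let `J` be a sorted column base of `A` (strictly monotone with `A_J` invertible),
`u` a row index, and `x` the basic solution associated with `J`, with
`x (J i) ≥ 0` for `i < u` and `x (J u) < 0`.  Suppose moreover that for some
invertible matrix `C` the transformed scheme `Ã = C A`, `b̃ = C b` has a row `r`
with `b̃ r < 0`, `Ã r j ≥ 0` for all columns `j < J u`, `Ã r (J u) < 0`, and
`Ã r (J i) = 0` for all `i > u`.  Then we get a contradiction. -/
theorem no_cycle_key_step (m n : ℕ)
    (A : Matrix (Fin m) (Fin n) ℝ) (b : Fin m → ℝ)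
    (J : Fin m → Fin n) (hJ : StrictMono J)
    (hreg : IsUnit (A.submatrix id J))
    (u : Fin m)
    (x : Fin n → ℝ)
    (hxJ : ∀ i : Fin m, x (J i) = ((A.submatrix id J)⁻¹ *ᵥ b) i)
    (hx0 : ∀ j : Fin n, j ∉ Set.range J → x j = 0)
    (hxnonneg : ∀ i : Fin m, i < u → 0 ≤ x (J i))
    (hxu : x (J u) < 0)
    (C : Matrix (Fin m) (Fin m) ℝ) (hC : IsUnit C)
    (Atil : Matrix (Fin m) (Fin n) ℝ) (btil : Fin m → ℝ)
    (hAtil : Atil = C * A) (hbtil : btil = C *ᵥ b)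
    (r : Fin m)
    (hb : btil r < 0)
    (hleft : ∀ j : Fin n, j < J u → 0 ≤ Atil r j)
    (hu : Atil r (J u) < 0)
    (hright : ∀ i : Fin m, u < i → Atil r (J i) = 0) :
    False := by
  have hbasis : A.submatrix id J *ᵥ (x ∘ J) = b := by
    have hxJ' : x ∘ J = (A.submatrix id J)⁻¹ *ᵥ b := funext hxJ
    rw [hxJ', mulVec_mulVec,
      mul_nonsing_inv _ ((isUnit_iff_isUnit_det _).mp hreg), one_mulVec]
  have hrow : btil r = ∑ i, Atil r (J i) * x (J i) := by
    have hsub : Atil.submatrix id J = C * A.submatrix id J := by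
      rw [hAtil]
      rfl
    have hsys : btil = Atil.submatrix id J *ᵥ (x ∘ J) := by
      rw [hsub, ← mulVec_mulVec, hbasis, hbtil]
    exact congrFun hsys r
  refine hb.not_ge (hrow ▸ Finset.sum_nonneg fun i _ => ?_)
  rcases lt_trichotomy i u with hi | rfl | hi
  · exact mul_nonneg (hleft _ (hJ hi)) (hxnonneg i hi)
  · exact mul_nonneg_of_nonpos_of_nonpos hu.le hxu.le
  · rw [hright i hi, zero_mul]
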